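/- Every finite bipartite simple graph G is net-positive: if G admits a proper 2-coloring of its vertices (no edge has both endpoints the same color), then c_0(G) > c_1(G). -/

import Mathlib

attribute [local instance] Classical.propDecidable

/-- The number of 2-colorings (`1` = black) of the vertices of `G` for which the
number of black-black edges is even. -/
noncomputable def colEven {V : Type*} [Fintype V] (G : SimpleGraph V) : ℕ :=
  (Finset.univ.filter fun x : V → Fin 2 =>
    Even (G.edgeFinset.filter fun e => ∀ v ∈ e, x v = 1).card).card

/-- The number of 2-colorings of the vertices of `G` for which the
number of black-black edges is odd. -/
noncomputable def colOdd {V : Type*} [Fintype V] (G : SimpleGraph V) : ℕ :=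
  (Finset.univ.filter fun x : V → Fin 2 =>
    Odd (G.edgeFinset.filter fun e => ∀ v ∈ e, x v = 1).card).card

/-- number of black neighbours of `a` -/
noncomputable def bdeg {V : Type*} [Fintype V] (G : SimpleGraph V) (x : V → Fin 2) (a : V) : ℕ :=
  (Finset.univ.filter fun b => G.Adj a b ∧ x b = 1).card

theorem bb_formula {V : Type*} [Fintype V] (G : SimpleGraph V) (c : V → Fin 2)
    (hc : ∀ a b : V, G.Adj a b → c a ≠ c b) (x : V → Fin 2) :
    (G.edgeFinset.filter fun e => ∀ v ∈ e, x v = 1).card =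
      ∑ a ∈ Finset.univ.filter (fun a => c a = 0), if x a = 1 then bdeg G x a else 0 := by
  rw [← Finset.sum_filter]
  unfold bdeg
  rw [← Finset.card_sigma]
  symm
  refine Finset.card_bij (fun p _ => s(p.1, p.2)) ?_ ?_ ?_
  · rintro ⟨a, b⟩ h
    simp at h ⊢
    tauto
  · rintro ⟨a, b⟩ h ⟨a', b'⟩ h' heq
    simp at h h' heq
    rcases heq with ⟨rfl, rfl⟩ | ⟨rfl, rfl⟩
    · rfl
    · exact absurd (h.1.1.trans h'.1.1.symm) (hc _ _ h.2.1)
  · intro e he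
    induction e using Sym2.ind with
    | _ a b =>
      simp at he
      have h1 := hc a b he.1
      by_cases ha : c a = 0
      · exact ⟨⟨a, b⟩, by simp; tauto, rfl⟩
      · have hb : c b = 0 := by omega
        exact ⟨⟨b, a⟩, by simp [G.adj_comm b a]; tauto, Sym2.eq_swap⟩

theorem stmt_14 {V : Type*} [Fintype V] (G : SimpleGraph V)
    (hbip : ∃ c : V → Fin 2, ∀ a b : V, G.Adj a b → c a ≠ c b) :
    colOdd G < colEven G := by
  obtain ⟨c, hc⟩ := hbip
  let P : (V → Fin 2) → Set V := fun x => {a | c a = 0 ∧ Odd (bdeg G x a)}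
  let f : (V → Fin 2) → (V → Fin 2) := fun x =>
    if h : (P x).Nonempty then Function.update x h.some (1 - x h.some) else x
  have hdeg : ∀ x a0 t, c a0 = 0 → ∀ a, c a = 0 →
      bdeg G (Function.update x a0 t) a = bdeg G x a := by
    intro x a0 t h0 a ha
    unfold bdeg
    congr 1
    ext b
    simp only [Finset.mem_filter, Finset.mem_univ, true_and]
    refine and_congr_right fun hab => ?_
    have : b ≠ a0 := by
      rintro rfl
      exact hc _ _ hab (ha.trans h0.symm)
    rw [Function.update_of_ne this]
  have hP : ∀ x a0 t, c a0 = 0 → P (Function.update x a0 t) = P x := by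
    intro x a0 t h0
    ext a
    refine and_congr_right fun ha => ?_
    rw [hdeg x a0 t h0 a ha]
  have hPf : ∀ x, P (f x) = P x := by
    intro x
    by_cases h : (P x).Nonempty
    · simp only [f, dif_pos h]
      exact hP _ _ _ h.some_mem.1
    · simp only [f, dif_neg h]
  have hff : ∀ x, f (f x) = x := by
    intro x
    by_cases h : (P x).Nonempty
    · have key : ∀ S : Set V, S = P x → ∀ hS : S.Nonempty, hS.some = h.some := by
        rintro S rfl hS
        rfl
      have h' : (P (f x)).Nonempty := by rw [hPf]; exact h
      have e1 : f (f x) = Function.update (f x) h'.some (1 - f x h'.some) := dif_pos h'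
      have e2 : f x = Function.update x h.some (1 - x h.some) := dif_pos h
      rw [e1, key _ (hPf x) h', e2]
      simp
    · have e2 : f x = x := dif_neg h
      rw [e2, e2]
  have hne : ∀ x, Odd (G.edgeFinset.filter fun e => ∀ v ∈ e, x v = 1).card →
      (P x).Nonempty := by
    intro x hx
    by_contra hcon
    rw [bb_formula G c hc x, ← Nat.not_even_iff_odd] at hx
    apply hx
    apply Finset.even_sum
    intro a ha
    split_ifs
    · by_contra h
      exact hcon ⟨a, (Finset.mem_filter.1 ha).2, Nat.not_even_iff_odd.1 h⟩
    · exact Even.zero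
  have hflip : ∀ x, Odd (G.edgeFinset.filter fun e => ∀ v ∈ e, x v = 1).card →
      Even (G.edgeFinset.filter fun e => ∀ v ∈ e, f x v = 1).card := by
    intro x hx
    have h := hne x hx
    have e2 : f x = Function.update x h.some (1 - x h.some) := dif_pos h
    obtain ⟨h0, hodd⟩ : h.some ∈ P x := h.some_mem
    rw [e2]
    generalize h.some = a0 at *
    rw [bb_formula G c hc] at hx ⊢
    have hm : a0 ∈ Finset.univ.filter (fun a => c a = 0) := by simp [h0]
    rw [← Finset.add_sum_erase _ _ hm] at hx ⊢
    have hs : ∑ a ∈ (Finset.univ.filter (fun a => c a = 0)).erase a0,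
        (if Function.update x a0 (1 - x a0) a = 1 then
          bdeg G (Function.update x a0 (1 - x a0)) a else 0) =
        ∑ a ∈ (Finset.univ.filter (fun a => c a = 0)).erase a0,
        (if x a = 1 then bdeg G x a else 0) := by
      refine Finset.sum_congr rfl fun a ha => ?_
      simp only [Finset.mem_erase, Finset.mem_filter, Finset.mem_univ, true_and] at ha
      rw [hdeg x a0 _ h0 a ha.2, Function.update_of_ne ha.1]
    rw [hs, hdeg x a0 _ h0 a0 h0, Function.update_self]
    have h01 : x a0 = 0 ∨ x a0 = 1 := by omega
    rcases h01 with h1 | h1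
    · simp only [h1] at hx ⊢
      simp at hx ⊢
      exact hodd.add_odd hx
    · simp only [h1] at hx ⊢
      simp at hx ⊢
      by_contra hcon
      rw [Nat.not_even_iff_odd] at hcon
      exact Nat.not_even_iff_odd.2 hx (hodd.add_odd hcon)
  have hzero : ¬ (P (fun _ => 0)).Nonempty := by
    rintro ⟨a, -, h⟩
    simp [bdeg] at h
  unfold colOdd colEven
  rw [← Finset.card_image_of_injective _ (Function.LeftInverse.injective hff)]
  apply Finset.card_lt_card
  rw [Finset.ssubset_iff_of_subset]
  · refine ⟨fun _ => 0, ?_, ?_⟩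
    · rw [Finset.mem_filter]
      refine ⟨Finset.mem_univ _, ?_⟩
      by_contra h
      exact hzero (hne _ (Nat.not_even_iff_odd.1 h))
    · intro h
      obtain ⟨y, hy, hy2⟩ := Finset.mem_image.1 h
      apply hzero
      rw [← hy2, hPf]
      exact hne _ (Finset.mem_filter.1 hy).2
  · intro z hz
    obtain ⟨y, hy, rfl⟩ := Finset.mem_image.1 hz
    exact Finset.mem_filter.2 ⟨Finset.mem_univ _, hflip _ (Finset.mem_filter.1 hy).2⟩
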